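/- In R = U[[h]] (Jordanian deformation of sl(3)): [E₁,T] = [E₁,T⁻¹] = [E₂,T] = [E₂,T⁻¹] = 0, [F₁,T] = hTE₂, [F₁,T⁻¹] = -hT⁻¹E₂, [F₂,T] = -hTE₁, and [F₂,T⁻¹] = hT⁻¹E₁ (all brackets are commutators [a,b]=ab-ba). -/

import Mathlib

noncomputable section

open LieAlgebra.SpecialLinear

attribute [local instance 100] LieRing.ofAssociativeRing

/-- The generalized binomial coefficient `α(α-1)⋯(α-n+1)/n!`. -/
def qbinom (α : ℚ) (n : ℕ) : ℚ :=
  (∏ i ∈ Finset.range n, (α - (i : ℚ))) / (n.factorial : ℚ)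

/-- `U(sl(3,ℂ))`, the universal enveloping algebra of `sl(3,ℂ)`. -/
abbrev Usl3 : Type := UniversalEnvelopingAlgebra ℂ (sl (Fin 3) ℂ)

namespace Usl3

/-- The canonical embedding `sl(3,ℂ) → U(sl(3,ℂ))`. -/
def ι : sl (Fin 3) ℂ →ₗ⁅ℂ⁆ Usl3 := UniversalEnvelopingAlgebra.ι ℂ

/-- `h₁`, the image of the matrix `E₁₁ - E₂₂`. -/
def h₁ : Usl3 := ι ⟨Matrix.single 0 0 1 - Matrix.single 1 1 1,
  show _ ∈ LinearMap.ker (Matrix.traceLinearMap (Fin 3) ℂ ℂ) by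
    simp [LinearMap.mem_ker, Matrix.trace_single_eq_same]⟩

/-- `h₂`, the image of the matrix `E₂₂ - E₃₃`. -/
def h₂ : Usl3 := ι ⟨Matrix.single 1 1 1 - Matrix.single 2 2 1,
  show _ ∈ LinearMap.ker (Matrix.traceLinearMap (Fin 3) ℂ ℂ) by
    simp [LinearMap.mem_ker, Matrix.trace_single_eq_same]⟩

/-- `e₁`, the image of the matrix `E₁₂`. -/
def e₁ : Usl3 := ι (single (n := Fin 3) (R := ℂ) 0 1 (by decide) 1)

/-- `e₂`, the image of the matrix `E₂₃`. -/
def e₂ : Usl3 := ι (single (n := Fin 3) (R := ℂ) 1 2 (by decide) 1)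

/-- `f₁`, the image of the matrix `E₂₁`. -/
def f₁ : Usl3 := ι (single (n := Fin 3) (R := ℂ) 1 0 (by decide) 1)

/-- `f₂`, the image of the matrix `E₃₂`. -/
def f₂ : Usl3 := ι (single (n := Fin 3) (R := ℂ) 2 1 (by decide) 1)

/-- `e₃ := e₁e₂ - e₂e₁`. -/
def e₃ : Usl3 := e₁ * e₂ - e₂ * e₁

/-- `f₃ := f₂f₁ - f₁f₂`. -/
def f₃ : Usl3 := f₂ * f₁ - f₁ * f₂

/-- `h₃ := h₁ + h₂`. -/
def h₃ : Usl3 := h₁ + h₂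

/-- `S := Σ_{n≥0} binom(1/2,n) h^{2n} e₃^{2n}` in `R = U(sl(3,ℂ))[[h]]`. -/
def S : PowerSeries Usl3 :=
  PowerSeries.mk fun m =>
    if m % 2 = 0 then ((qbinom (1/2) (m / 2) : ℚ) : ℂ) • e₃ ^ m else 0

/-- `T := h·e₃ + S`. -/
def T : PowerSeries Usl3 := PowerSeries.X * PowerSeries.C e₃ + S

/-- `T⁻¹ := -h·e₃ + S`. -/
def Tinv : PowerSeries Usl3 := -(PowerSeries.X * PowerSeries.C e₃) + S

/-- `Σ_{n≥0} binom(α,n)(T-1)ⁿ`, well defined since `T - 1` has zero constant term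
(the degree-`m` coefficient only receives contributions from `n ≤ m`). -/
def Tpow (α : ℚ) : PowerSeries Usl3 :=
  PowerSeries.mk fun m =>
    PowerSeries.coeff m
      (∑ n ∈ Finset.range (m + 1), ((qbinom α n : ℚ) : ℂ) • (T - 1) ^ n)

/-- `T^{1/2} := Σ_{n≥0} binom(1/2,n)(T-1)ⁿ`. -/
def Thalf : PowerSeries Usl3 := Tpow (1/2)

/-- `T^{-1/2} := Σ_{n≥0} binom(-1/2,n)(T-1)ⁿ`. -/
def Tneghalf : PowerSeries Usl3 := Tpow (-(1/2))

/-- `E₁ := T^{1/2}e₁`. -/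
def E₁ : PowerSeries Usl3 := Thalf * PowerSeries.C e₁

/-- `E₂ := T^{1/2}e₂`. -/
def E₂ : PowerSeries Usl3 := Thalf * PowerSeries.C e₂

/-- `H₃ := S·h₃`. -/
def H₃ : PowerSeries Usl3 := S * PowerSeries.C h₃

/-- `F₃ := f₃ - (h²/4)e₃(h₃² - 1)`. -/
def F₃ : PowerSeries Usl3 :=
  PowerSeries.C f₃ -
    (1/4 : ℂ) • (PowerSeries.X ^ 2 * PowerSeries.C (e₃ * (h₃ ^ 2 - 1)))

/-- `H₁ := h₁ - (h/2)e₃T⁻¹h₃`. -/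
def H₁ : PowerSeries Usl3 :=
  PowerSeries.C h₁ -
    (1/2 : ℂ) • (PowerSeries.X * PowerSeries.C e₃ * Tinv * PowerSeries.C h₃)

/-- `H₂ := h₂ - (h/2)e₃T⁻¹h₃`. -/
def H₂ : PowerSeries Usl3 :=
  PowerSeries.C h₂ -
    (1/2 : ℂ) • (PowerSeries.X * PowerSeries.C e₃ * Tinv * PowerSeries.C h₃)

/-- `F₁ := T^{-1/2}(f₁ + (h/2)e₂Th₃)`. -/
def F₁ : PowerSeries Usl3 :=
  Tneghalf * (PowerSeries.C f₁ +
    (1/2 : ℂ) • (PowerSeries.X * PowerSeries.C e₂ * T * PowerSeries.C h₃))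

/-- `F₂ := T^{-1/2}(f₂ - (h/2)e₁Th₃)`. -/
def F₂ : PowerSeries Usl3 :=
  Tneghalf * (PowerSeries.C f₂ -
    (1/2 : ℂ) • (PowerSeries.X * PowerSeries.C e₁ * T * PowerSeries.C h₃))

end Usl3

namespace Usl3

open PowerSeries

section ScaledSeries

variable {A : Type*} [Ring A] [Algebra ℂ A]

/-- The ring homomorphism `f(X) ↦ f(X·a)` from `ℂ⟦X⟧` to `A⟦X⟧`. -/
def scaledSeries (a : A) : PowerSeries ℂ →+* PowerSeries A where
  toFun f := PowerSeries.mk fun n => coeff n f • a ^ n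
  map_one' := by
    ext n
    rcases eq_or_ne n 0 with rfl | hn
    · simp
    · simp [coeff_one, hn]
  map_mul' f g := by
    ext n
    simp only [coeff_mk, coeff_mul, Finset.sum_smul]
    refine Finset.sum_congr rfl fun p hp => ?_
    rw [smul_mul_smul_comm, ← pow_add, Finset.HasAntidiagonal.mem_antidiagonal.1 hp]
  map_zero' := by ext n; simp
  map_add' f g := by ext n; simp [add_smul]

lemma coeff_scaledSeries (a : A) (f : PowerSeries ℂ) (n : ℕ) :
    coeff n (scaledSeries a f) = coeff n f • a ^ n := by
  change coeff n (PowerSeries.mk fun n => coeff n f • a ^ n) = _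
  rw [coeff_mk]

lemma scaledSeries_X (a : A) : scaledSeries a X = X * C a := by
  ext n
  rw [coeff_scaledSeries]
  rcases n with _ | n
  · simp
  · rw [coeff_succ_X_mul, coeff_C, coeff_X]
    rcases n with _ | n <;> simp

lemma scaledSeries_smul (a : A) (c : ℂ) (f : PowerSeries ℂ) :
    scaledSeries a (c • f) = c • scaledSeries a f := by
  ext n
  simp [coeff_scaledSeries, mul_smul]

lemma commutator_pow {y a z : A} (hy : y * a - a * y = z) (hz : Commute z a) (n : ℕ) :
    y * a ^ (n + 1) - a ^ (n + 1) * y = ((n + 1 : ℕ) : ℂ) • (a ^ n * z) := by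
  induction n with
  | zero => simpa using hy
  | succ n ih =>
    have hz' : z * a = a * z := hz
    have hstep : y * a ^ (n + 2) - a ^ (n + 2) * y =
        (y * a ^ (n + 1) - a ^ (n + 1) * y) * a + a ^ (n + 1) * (y * a - a * y) := by
      rw [pow_succ a (n + 1)]
      noncomm_ring
    rw [hstep, ih, hy, smul_mul_assoc, mul_assoc, hz', ← mul_assoc, ← pow_succ]
    push_cast
    module

/-- If `[y, a] = z` commutes with `a`, then `[y, f(X·a)] = X·f'(X·a)·z`. -/
lemma commutator_scaledSeries {y a z : A} (hy : y * a - a * y = z) (hz : Commute z a)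
    (f : PowerSeries ℂ) :
    C y * scaledSeries a f - scaledSeries a f * C y =
      X * scaledSeries a (derivative ℂ f) * C z := by
  ext n
  rw [map_sub, coeff_C_mul, coeff_mul_C, coeff_mul_C, coeff_scaledSeries]
  rcases n with _ | n
  · simp
  · rw [coeff_succ_X_mul, coeff_scaledSeries, coeff_derivative, mul_smul_comm, smul_mul_assoc,
      ← smul_sub, commutator_pow hy hz, smul_smul, smul_mul_assoc]
    push_cast
    rfl

lemma commute_C_scaledSeries {y a : A} (hy : Commute y a) (f : PowerSeries ℂ) :
    Commute (C y) (scaledSeries a f) := by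
  have h := commutator_scaledSeries (sub_eq_zero.2 hy.eq) (Commute.zero_left a) f
  rw [map_zero, mul_zero] at h
  exact sub_eq_zero.1 h

lemma commute_scaledSeries (a : A) (f g : PowerSeries ℂ) :
    Commute (scaledSeries a f) (scaledSeries a g) :=
  (Commute.all f g).map (scaledSeries a)

end ScaledSeries

section ScalarSeries

lemma qbinom_eq_choose (α : ℚ) (n : ℕ) : qbinom α n = Ring.choose α n := by
  have h : ∀ n : ℕ, ∏ i ∈ Finset.range n, (α - (i : ℚ)) = (descPochhammer ℤ n).smeval α := by
    intro n
    induction n with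
    | zero => simp
    | succ n ih =>
      rw [Finset.prod_range_succ, ih, descPochhammer_succ_right, Polynomial.smeval_mul,
        Polynomial.smeval_sub, Polynomial.smeval_X, Polynomial.smeval_natCast]
      simp
  rw [qbinom, h, Ring.choose_eq_smul, smul_eq_mul, div_eq_inv_mul]

lemma coeff_binomialSeries_complex (α : ℚ) (n : ℕ) :
    coeff n (PowerSeries.binomialSeries ℂ α) = ((qbinom α n : ℚ) : ℂ) := by
  rw [binomialSeries_coeff, qbinom_eq_choose, Rat.smul_def, mul_one]

/-- The series `(1 + X²)^{1/2}`. -/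
def sqrtSeries : PowerSeries ℂ := (PowerSeries.binomialSeries ℂ (1 / 2 : ℚ)).subst (X ^ 2 : PowerSeries ℂ)

lemma sqrtSeries_mul_self : sqrtSeries * sqrtSeries = 1 + X ^ 2 := by
  have hX : HasSubst (X ^ 2 : PowerSeries ℂ) := HasSubst.X_pow two_ne_zero
  have hb : PowerSeries.binomialSeries ℂ (1 / 2 : ℚ) * PowerSeries.binomialSeries ℂ (1 / 2 : ℚ) = 1 + X := by
    rw [← binomialSeries_add, add_halves]
    simpa using binomialSeries_nat (R := ℚ) (A := ℂ) 1
  rw [sqrtSeries, ← subst_mul hX, hb, ← coe_substAlgHom hX, map_add, map_one, substAlgHom_X]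

lemma coeff_sqrtSeries (m : ℕ) :
    coeff m sqrtSeries = if m % 2 = 0 then ((qbinom (1 / 2) (m / 2) : ℚ) : ℂ) else 0 := by
  rw [sqrtSeries, coeff_subst_X_pow two_ne_zero]
  simp only [coeff_binomialSeries_complex, Nat.dvd_iff_mod_eq_zero, Algebra.algebraMap_self,
    RingHom.id_apply]

lemma constantCoeff_sqrtSeries : constantCoeff sqrtSeries = 1 := by
  rw [← coeff_zero_eq_constantCoeff_apply, coeff_sqrtSeries]
  simp [qbinom]

lemma sqrtSeries_mul_derivative : sqrtSeries * derivative ℂ sqrtSeries = X := by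
  have h := congrArg (derivative ℂ) sqrtSeries_mul_self
  rw [Derivation.leibniz, map_add, Derivation.map_one_eq_zero, derivative_pow, derivative_X] at h
  simp only [smul_eq_mul] at h
  have h2 : C (1 / 2 : ℂ) * 2 = 1 := by
    rw [← map_ofNat C 2, ← map_mul]
    norm_num
  norm_num at h
  linear_combination (X - sqrtSeries * derivative ℂ sqrtSeries) * h2 + C (1 / 2) * h

/-- The series `X + (1 + X²)^{1/2}`. -/
def tSeries : PowerSeries ℂ := X + sqrtSeries

/-- The series `-X + (1 + X²)^{1/2}`. -/
def tinvSeries : PowerSeries ℂ := -X + sqrtSeries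

lemma tinvSeries_mul_tSeries : tinvSeries * tSeries = 1 := by
  rw [tinvSeries, tSeries]
  linear_combination sqrtSeries_mul_self

lemma one_add_X_mul_tSeries : 1 + X * tSeries = sqrtSeries * tSeries := by
  rw [tSeries]
  linear_combination -sqrtSeries_mul_self

lemma derivative_tSeries_mul :
    derivative ℂ tSeries * (1 + X * tSeries) = tSeries ^ 2 := by
  have h : sqrtSeries * derivative ℂ tSeries = tSeries := by
    rw [tSeries, map_add, derivative_X]
    linear_combination sqrtSeries_mul_derivative
  rw [one_add_X_mul_tSeries]
  linear_combination tSeries * h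

lemma derivative_tinvSeries_mul :
    derivative ℂ tinvSeries * (1 + X * tSeries) = -1 := by
  have h : sqrtSeries * derivative ℂ tinvSeries = -tinvSeries := by
    rw [tinvSeries, map_add, map_neg, derivative_X]
    linear_combination sqrtSeries_mul_derivative
  rw [one_add_X_mul_tSeries]
  linear_combination tSeries * h - tinvSeries_mul_tSeries

lemma constantCoeff_tSeries_sub_one : constantCoeff (tSeries - 1) = 0 := by
  simp [tSeries, constantCoeff_sqrtSeries]

/-- The binomial series of exponent `α` evaluated at `tSeries - 1`. -/
def tpowSeries (α : ℚ) : PowerSeries ℂ := (PowerSeries.binomialSeries ℂ α).subst (tSeries - 1)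

lemma coeff_tpowSeries (α : ℚ) (m : ℕ) :
    coeff m (tpowSeries α) =
      coeff m (∑ n ∈ Finset.range (m + 1), ((qbinom α n : ℚ) : ℂ) • (tSeries - 1) ^ n) := by
  rw [tpowSeries, coeff_subst' (HasSubst.of_constantCoeff_zero' constantCoeff_tSeries_sub_one),
    finsum_eq_sum_of_support_subset (s := Finset.range (m + 1)), map_sum]
  · simp only [coeff_binomialSeries_complex, coeff_smul, smul_eq_mul]
  · intro n hn
    by_contra hmn
    refine hn ?_
    have hlt : m < n := by simpa using hmn
    have hX : X ^ n ∣ (tSeries - 1) ^ n :=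
      pow_dvd_pow_of_dvd (X_dvd_iff.2 constantCoeff_tSeries_sub_one) n
    simp only [X_pow_dvd_iff.1 hX m hlt, smul_zero]

lemma tpowSeries_add_one (α : ℚ) : tpowSeries (α + 1) = tpowSeries α * tSeries := by
  have ht : HasSubst (tSeries - 1) :=
    HasSubst.of_constantCoeff_zero' constantCoeff_tSeries_sub_one
  have hb : PowerSeries.binomialSeries ℂ (1 : ℚ) = 1 + X := by
    simpa using binomialSeries_nat (R := ℚ) (A := ℂ) 1
  have h : (1 + X : PowerSeries ℂ).subst (tSeries - 1) = tSeries := by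
    rw [← coe_substAlgHom ht, map_add, map_one, substAlgHom_X]
    exact add_sub_cancel _ _
  rw [tpowSeries, binomialSeries_add, subst_mul ht, hb, h, tpowSeries]

end ScalarSeries

lemma S_eq_scaledSeries : S = scaledSeries e₃ sqrtSeries := by
  ext m
  rw [coeff_scaledSeries, coeff_sqrtSeries, S, coeff_mk, ite_smul, zero_smul]

lemma T_eq_scaledSeries : T = scaledSeries e₃ tSeries := by
  rw [tSeries, map_add, scaledSeries_X, ← S_eq_scaledSeries, T]

lemma Tinv_eq_scaledSeries : Tinv = scaledSeries e₃ tinvSeries := by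
  rw [tinvSeries, map_add, map_neg, scaledSeries_X, ← S_eq_scaledSeries, Tinv]

lemma Tpow_eq_scaledSeries (α : ℚ) : Tpow α = scaledSeries e₃ (tpowSeries α) := by
  ext m
  rw [Tpow, coeff_mk, coeff_scaledSeries, coeff_tpowSeries, ← coeff_scaledSeries]
  simp only [map_sum, scaledSeries_smul, map_pow, map_sub, map_one, T_eq_scaledSeries]

lemma Thalf_eq : Thalf = scaledSeries e₃ (tpowSeries (-(1 / 2)) * tSeries) := by
  rw [Thalf, Tpow_eq_scaledSeries, ← tpowSeries_add_one]
  norm_num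

lemma ι_commutator (x y : sl (Fin 3) ℂ) : ι x * ι y - ι y * ι x = ι ⁅x, y⁆ := by
  rw [LieHom.map_lie]
  rfl

lemma e₃_eq : e₃ = ι (single (n := Fin 3) (R := ℂ) 0 2 (by decide) 1) := by
  rw [e₃, e₁, e₂, ι_commutator]
  congr 1
  ext i j
  fin_cases i <;> fin_cases j <;> simp [Matrix.single, Matrix.mul_apply, Ring.lie_def]

lemma commute_e₁_e₃ : Commute e₁ e₃ := by
  rw [Commute, SemiconjBy, ← sub_eq_zero, e₃_eq, e₁, ι_commutator, ← map_zero ι]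
  congr 1
  ext i j
  fin_cases i <;> fin_cases j <;> simp [Matrix.single, Matrix.mul_apply, Ring.lie_def]

lemma commute_e₂_e₃ : Commute e₂ e₃ := by
  rw [Commute, SemiconjBy, ← sub_eq_zero, e₃_eq, e₂, ι_commutator, ← map_zero ι]
  congr 1
  ext i j
  fin_cases i <;> fin_cases j <;> simp [Matrix.single, Matrix.mul_apply, Ring.lie_def]

lemma commutator_f₁_e₃ : f₁ * e₃ - e₃ * f₁ = e₂ := by
  rw [e₃_eq, f₁, e₂, ι_commutator]
  congr 1
  ext i j
  fin_cases i <;> fin_cases j <;> simp [Matrix.single, Matrix.mul_apply, Ring.lie_def]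

lemma commutator_f₂_e₃ : f₂ * e₃ - e₃ * f₂ = -e₁ := by
  rw [e₃_eq, f₂, e₁, ι_commutator, ← map_neg]
  congr 1
  ext i j
  fin_cases i <;> fin_cases j <;> simp [Matrix.single, Matrix.mul_apply, Ring.lie_def]

lemma commutator_h₃_e₃ : h₃ * e₃ - e₃ * h₃ = (2 : ℂ) • e₃ := by
  rw [e₃_eq, h₃, h₁, h₂, ← map_add, ι_commutator, ← map_smul]
  congr 1
  ext i j
  fin_cases i <;> fin_cases j <;> simp [Matrix.single, Matrix.mul_apply, Ring.lie_def]
  norm_num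

/-- The commutator with `f(h·e₃)` of the common form of `F₁` (with `c = 1/2`) and `F₂`
(with `c = -1/2`). -/
lemma commutator_F {y z : Usl3} {c : ℂ} (hz : Commute z e₃)
    (hy : y * e₃ - e₃ * y = (2 * c) • z) (g f : PowerSeries ℂ) :
    scaledSeries e₃ g * (C y + c • (X * C z * T * C h₃)) * scaledSeries e₃ f -
        scaledSeries e₃ f * (scaledSeries e₃ g * (C y + c • (X * C z * T * C h₃))) =
      (2 * c) • (X * scaledSeries e₃ (g * (derivative ℂ f * (1 + X * tSeries))) * C z) := by
  have hcy := commutator_scaledSeries hy (hz.smul_left (2 * c)) f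
  have hch := commutator_scaledSeries commutator_h₃_e₃
    ((Commute.refl e₃).smul_left (2 : ℂ)) f
  have hC (r : ℂ) (x : Usl3) : C (r • x) = r • C x := by
    ext n
    simp only [coeff_C, coeff_smul]
    split_ifs <;> simp
  have hcz := commute_C_scaledSeries hz
  have hP : Commute (scaledSeries e₃ f) (X * C z * T) :=
    ((commute_X _).mul_right (hcz f).symm).mul_right
      (T_eq_scaledSeries ▸ commute_scaledSeries e₃ f tSeries)
  have hh : C h₃ * scaledSeries e₃ f - scaledSeries e₃ f * C h₃ =
      (2 : ℂ) • scaledSeries e₃ (derivative ℂ f * X) := by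
    rw [hch, hC, mul_smul_comm, map_mul, scaledSeries_X, ← mul_assoc, (commute_X _).eq]
  have hsplit : scaledSeries e₃ g * (C y + c • (X * C z * T * C h₃)) * scaledSeries e₃ f -
        scaledSeries e₃ f * (scaledSeries e₃ g * (C y + c • (X * C z * T * C h₃))) =
      scaledSeries e₃ g * ((C y * scaledSeries e₃ f - scaledSeries e₃ f * C y) +
        c • (X * C z * T * (C h₃ * scaledSeries e₃ f - scaledSeries e₃ f * C h₃))) := by
    generalize X * C z * T = w at hP ⊢
    rw [mul_assoc (scaledSeries e₃ g), ← mul_assoc (scaledSeries e₃ f),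
      (commute_scaledSeries e₃ f g).eq, mul_assoc (scaledSeries e₃ g), ← mul_sub]
    congr 1
    rw [add_mul, mul_add, smul_mul_assoc, mul_smul_comm, mul_sub, smul_sub,
      ← mul_assoc (scaledSeries e₃ f) w, hP.eq, mul_assoc, mul_assoc]
    abel
  rw [hsplit, hcy, hh, hC, T_eq_scaledSeries, mul_smul_comm, mul_smul_comm, smul_smul,
    mul_comm c 2, ← smul_add, mul_smul_comm]
  congr 1
  rw [mul_assoc X (C z), (hcz tSeries).eq, ← mul_assoc X, mul_assoc _ (C z), (hcz _).eq,
    ← mul_assoc _ _ (C z), ← add_mul, mul_assoc X, ← map_mul, ← mul_add, ← map_add, ← mul_assoc,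
    ← mul_assoc, ← (commute_X (scaledSeries e₃ g)).symm.eq, mul_assoc X, ← map_mul]
  congr 4
  ring

end Usl3

open Usl3 in
/-- In `R = U(sl(3,ℂ))[[h]]` (Jordanian deformation of `sl(3)`):
`[E₁,T] = [E₁,T⁻¹] = [E₂,T] = [E₂,T⁻¹] = 0`, `[F₁,T] = hTE₂`, `[F₁,T⁻¹] = -hT⁻¹E₂`,
`[F₂,T] = -hTE₁`, `[F₂,T⁻¹] = hT⁻¹E₁`. -/
theorem statement_8 :
    E₁ * T - T * E₁ = 0 ∧
    E₁ * Tinv - Tinv * E₁ = 0 ∧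
    E₂ * T - T * E₂ = 0 ∧
    E₂ * Tinv - Tinv * E₂ = 0 ∧
    F₁ * T - T * F₁ = PowerSeries.X * (T * E₂) ∧
    F₁ * Tinv - Tinv * F₁ = -(PowerSeries.X * (Tinv * E₂)) ∧
    F₂ * T - T * F₂ = -(PowerSeries.X * (T * E₁)) ∧
    F₂ * Tinv - Tinv * F₂ = PowerSeries.X * (Tinv * E₁) := by
  have hE {e : Usl3} (he : Commute e e₃) (f : PowerSeries ℂ) :
      Thalf * PowerSeries.C e * scaledSeries e₃ f =
        scaledSeries e₃ f * (Thalf * PowerSeries.C e) := by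
    rw [Thalf_eq]
    exact ((commute_scaledSeries e₃ _ f).mul_left (commute_C_scaledSeries he f)).eq
  have hT (g : PowerSeries ℂ) : g * (PowerSeries.derivative ℂ tSeries *
      (1 + PowerSeries.X * tSeries)) = tSeries * (g * tSeries) := by
    rw [derivative_tSeries_mul]
    ring
  have hTinv (g : PowerSeries ℂ) : g * (PowerSeries.derivative ℂ tinvSeries *
      (1 + PowerSeries.X * tSeries)) = -(tinvSeries * (g * tSeries)) := by
    rw [derivative_tinvSeries_mul]
    linear_combination g * tinvSeries_mul_tSeries
  have hf₁ : f₁ * e₃ - e₃ * f₁ = (2 * (1 / 2) : ℂ) • e₂ := by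
    rw [commutator_f₁_e₃]
    norm_num
  have hf₂ : f₂ * e₃ - e₃ * f₂ = (2 * (-(1 / 2)) : ℂ) • e₁ := by
    rw [commutator_f₂_e₃]
    norm_num
  have hF₁ := commutator_F commute_e₂_e₃ hf₁ (tpowSeries (-(1 / 2)))
  have hF₂ := commutator_F commute_e₁_e₃ hf₂ (tpowSeries (-(1 / 2)))
  rw [← Tpow_eq_scaledSeries] at hF₁ hF₂
  simp only [neg_smul, ← sub_eq_add_neg] at hF₂
  refine ⟨?_, ?_, ?_, ?_, ?_, ?_, ?_, ?_⟩
  · rw [E₁, T_eq_scaledSeries, hE commute_e₁_e₃, sub_self]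
  · rw [E₁, Tinv_eq_scaledSeries, hE commute_e₁_e₃, sub_self]
  · rw [E₂, T_eq_scaledSeries, hE commute_e₂_e₃, sub_self]
  · rw [E₂, Tinv_eq_scaledSeries, hE commute_e₂_e₃, sub_self]
  · have h := hF₁ tSeries
    rw [hT, map_mul, ← Thalf_eq, ← T_eq_scaledSeries] at h
    rw [F₁, Tneghalf, h, E₂]
    norm_num [mul_assoc]
  · have h := hF₁ tinvSeries
    rw [hTinv, map_neg, map_mul, ← Thalf_eq, ← Tinv_eq_scaledSeries] at h
    rw [F₁, Tneghalf, h, E₂]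
    norm_num [mul_assoc]
  · have h := hF₂ tSeries
    rw [hT, map_mul, ← Thalf_eq, ← T_eq_scaledSeries] at h
    rw [F₂, Tneghalf, h, E₁]
    norm_num [mul_assoc]
  · have h := hF₂ tinvSeries
    rw [hTinv, map_neg, map_mul, ← Thalf_eq, ← Tinv_eq_scaledSeries] at h
    rw [F₂, Tneghalf, h, E₁]
    norm_num [mul_assoc]
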